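/- arXiv:0906.0195 — 2 statements merged into one kernel-verified Lean document; each statement's English description precedes it below -/
import Mathlib

section
/- (Main theorem) Let X be an s-distance set on the unit sphere S^{d-1} in ℝ^d, and let F_X(t) := ∏_{α ∈ A(X)} (t − α). Write the Gegenbauer expansion F_X(t) = Σ_{i=0}^{s} f_i · G_i^{(d)}(t) with real coefficients f_i. Then |X| ≤ Σ_{i : f_i > 0} h_i, where the sum runs over those indices 0 ≤ i ≤ s with f_i > 0, and h_i = C(d+i−1, i) − C(d+i−3, i−2). -/
open scoped RealInnerProductSpace

/-- The set of inner products between distinct points of a finite subset of `ℝ^d`. -/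
noncomputable def innerSet {d : ℕ} (X : Finset (EuclideanSpace ℝ (Fin d))) : Finset ℝ :=
  haveI := Classical.decEq (EuclideanSpace ℝ (Fin d))
  haveI := Classical.decEq ℝ
  X.offDiag.image (fun p => ⟪p.1, p.2⟫)

/-- The Gegenbauer polynomials `G_l^{(d)}`, defined by `G_0 = 1`, `G_1 = d·t` and the
recurrence `t·G_l = λ_{l+1}·G_{l+1} + (1 - λ_{l-1})·G_{l-1}` with `λ_l = l/(d+2l-2)`. -/
noncomputable def Geg (d : ℕ) : ℕ → Polynomial ℝ
  | 0 => 1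
  | 1 => Polynomial.C (d : ℝ) * Polynomial.X
  | (n+2) => Polynomial.C (((d : ℝ) + 2*(n+2) - 2)/((n : ℝ)+2)) *
      (Polynomial.X * Geg d (n+1) - Polynomial.C (1 - (n : ℝ)/((d : ℝ)+2*n-2)) * Geg d n)

/-- `h_l = C(d+l-1, l) - C(d+l-3, l-2)` (with the convention `C(n,k) = 0` for `k < 0`),
the dimension of the space of harmonic homogeneous polynomials of degree `l` in `d` variables. -/
def hDim (d l : ℕ) : ℕ :=
  Nat.choose (d + l - 1) l - (if 2 ≤ l then Nat.choose (d + l - 3) (l - 2) else 0)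

section ZonalHarmonics

open MvPolynomial

variable {σ : Type*}

/-- The Fischer inner product `⟨p, q⟩ = ∑ₘ m! pₘ qₘ` on real polynomials. -/
noncomputable def fischer :
    MvPolynomial σ ℝ →ₗ[ℝ] MvPolynomial σ ℝ →ₗ[ℝ] ℝ :=
  (basisMonomials σ ℝ).constr ℝ fun m =>
    (m.prod fun _ k => (k.factorial : ℝ)) • lcoeff (R := ℝ) m

theorem fischer_monomial (m : σ →₀ ℕ) (a : ℝ) (q : MvPolynomial σ ℝ) :
    fischer (monomial m a) q = a * ((m.prod fun _ k => (k.factorial : ℝ)) * coeff m q) := by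
  have h : monomial m a = a • basisMonomials σ ℝ m := by simp [smul_monomial]
  rw [h, map_smul, fischer, Module.Basis.constr_basis]
  simp

theorem fischer_one (q : MvPolynomial σ ℝ) : fischer 1 q = coeff 0 q := by
  simpa using fischer_monomial 0 1 q

theorem fischer_self (p : MvPolynomial σ ℝ) :
    fischer p p = ∑ m ∈ p.support, (m.prod fun _ k => (k.factorial : ℝ)) * coeff m p ^ 2 := by
  conv_lhs => enter [1]; rw [p.as_sum]
  simp only [map_sum, LinearMap.sum_apply, fischer_monomial]
  exact Finset.sum_congr rfl fun m _ => by ring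

theorem prod_factorial_pos (m : σ →₀ ℕ) : 0 < m.prod fun _ k => (k.factorial : ℝ) :=
  Finset.prod_pos fun _ _ => by positivity

theorem fischer_self_nonneg (p : MvPolynomial σ ℝ) : 0 ≤ fischer p p := by
  rw [fischer_self]
  exact Finset.sum_nonneg fun m _ => mul_nonneg (prod_factorial_pos m).le (sq_nonneg _)

theorem eq_zero_of_fischer_self_eq_zero {p : MvPolynomial σ ℝ} (h : fischer p p = 0) : p = 0 := by
  rw [fischer_self, Finset.sum_eq_zero_iff_of_nonneg fun m _ =>
    mul_nonneg (prod_factorial_pos m).le (sq_nonneg _)] at h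
  by_contra hp
  obtain ⟨m, hm⟩ := ne_zero_iff.mp hp
  have := h m (mem_support_iff.mpr hm)
  simp [hm, (prod_factorial_pos m).ne'] at this

theorem fischer_X_mul (i : σ) (p q : MvPolynomial σ ℝ) :
    fischer (X i * p) q = fischer p (pderiv i q) := by
  classical
  induction p using MvPolynomial.induction_on' with
  | add p₁ p₂ h₁ h₂ => simp only [mul_add, map_add, LinearMap.add_apply, h₁, h₂]
  | monomial m a =>
    have hprod : ((m + Finsupp.single i 1).prod fun _ k => (k.factorial : ℝ)) =
        (m.prod fun _ k => (k.factorial : ℝ)) * (m i + 1) := by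
      rw [← Finsupp.mul_prod_erase' (m + Finsupp.single i 1) i _ (by simp),
        ← Finsupp.mul_prod_erase' m i _ (by simp)]
      simp [Finsupp.erase_add, Nat.factorial_succ]
      ring
    have h : X i * monomial m a = monomial (m + Finsupp.single i 1) a := by
      rw [X, monomial_mul, one_mul, add_comm]
    rw [h, fischer_monomial, fischer_monomial, coeff_pderiv, hprod]
    ring

variable [Fintype σ]

/-- The linear form `x ↦ ∑ᵢ yᵢ xᵢ`. -/
noncomputable def linForm (y : σ → ℝ) : MvPolynomial σ ℝ := ∑ i, C (y i) * X i

/-- The squared norm `x ↦ ∑ᵢ xᵢ²`. -/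
noncomputable def normSqPoly (σ : Type*) [Fintype σ] : MvPolynomial σ ℝ := ∑ i, X i * X i

/-- The derivative in the direction `y`. -/
noncomputable def dirDeriv (y : σ → ℝ) : MvPolynomial σ ℝ →ₗ[ℝ] MvPolynomial σ ℝ :=
  ∑ i, y i • (pderiv (R := ℝ) i).toLinearMap

/-- The Laplacian. -/
noncomputable def laplacian (σ : Type*) [Fintype σ] :
    MvPolynomial σ ℝ →ₗ[ℝ] MvPolynomial σ ℝ :=
  ∑ i, (pderiv (R := ℝ) i).toLinearMap ∘ₗ (pderiv (R := ℝ) i).toLinearMap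

theorem dirDeriv_apply (y : σ → ℝ) (p : MvPolynomial σ ℝ) :
    dirDeriv y p = ∑ i, C (y i) * pderiv i p := by
  simp [dirDeriv, smul_eq_C_mul]

theorem laplacian_apply (p : MvPolynomial σ ℝ) :
    laplacian σ p = ∑ i, pderiv i (pderiv i p) := by
  simp [laplacian]

theorem pderiv_linForm (y : σ → ℝ) (i : σ) : pderiv i (linForm y) = C (y i) := by
  classical
  simp [linForm, pderiv_X, Pi.single_apply]

theorem pderiv_normSqPoly (i : σ) : pderiv i (normSqPoly σ) = 2 * X i := by
  classical
  simp [normSqPoly, pderiv_X, Pi.single_apply, Finset.sum_add_distrib]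
  ring

theorem dirDeriv_mul (y : σ → ℝ) (p q : MvPolynomial σ ℝ) :
    dirDeriv y (p * q) = dirDeriv y p * q + p * dirDeriv y q := by
  simp only [dirDeriv_apply, pderiv_mul, Finset.sum_mul, Finset.mul_sum, ← Finset.sum_add_distrib]
  exact Finset.sum_congr rfl fun i _ => by ring

theorem dirDeriv_linForm {y : σ → ℝ} (hy : ∑ i, y i ^ 2 = 1) : dirDeriv y (linForm y) = 1 := by
  simp only [dirDeriv_apply, pderiv_linForm, ← pow_two, ← map_pow, ← map_sum, hy, map_one]

theorem dirDeriv_normSqPoly (y : σ → ℝ) : dirDeriv y (normSqPoly σ) = 2 * linForm y := by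
  simp only [dirDeriv_apply, pderiv_normSqPoly, linForm, Finset.mul_sum]
  exact Finset.sum_congr rfl fun i _ => by ring

theorem laplacian_C_mul (a : ℝ) (p : MvPolynomial σ ℝ) :
    laplacian σ (C a * p) = C a * laplacian σ p := by
  rw [← smul_eq_C_mul, map_smul, smul_eq_C_mul]

theorem dirDeriv_C_mul (y : σ → ℝ) (a : ℝ) (p : MvPolynomial σ ℝ) :
    dirDeriv y (C a * p) = C a * dirDeriv y p := by
  rw [← smul_eq_C_mul, map_smul, smul_eq_C_mul]

theorem laplacian_linForm_mul (y : σ → ℝ) (p : MvPolynomial σ ℝ) :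
    laplacian σ (linForm y * p) = linForm y * laplacian σ p + 2 * dirDeriv y p := by
  simp only [laplacian_apply, dirDeriv_apply, pderiv_mul, pderiv_linForm, map_add, pderiv_C,
    Finset.mul_sum, ← Finset.sum_add_distrib]
  exact Finset.sum_congr rfl fun i _ => by ring

theorem laplacian_normSqPoly_mul {p : MvPolynomial σ ℝ} {n : ℕ} (hp : p.IsHomogeneous n) :
    laplacian σ (normSqPoly σ * p) =
      normSqPoly σ * laplacian σ p + C (2 * Fintype.card σ + 4 * n : ℝ) * p := by
  have h : ∀ i : σ, pderiv (R := ℝ) i (pderiv i (normSqPoly σ * p)) =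
      normSqPoly σ * pderiv i (pderiv i p) + (4 : MvPolynomial σ ℝ) * (X i * pderiv i p) +
        (2 : MvPolynomial σ ℝ) * p := fun i => by
    have h2 : (2 : MvPolynomial σ ℝ) = C 2 := (map_ofNat C 2).symm
    simp only [pderiv_mul, pderiv_normSqPoly, map_add]
    rw [h2, pderiv_C, pderiv_X_self, ← h2]
    ring
  simp only [laplacian_apply, h, Finset.sum_add_distrib, ← Finset.mul_sum, hp.sum_X_mul_pderiv]
  simp [map_ofNat C]
  ring

theorem laplacian_dirDeriv (y : σ → ℝ) (p : MvPolynomial σ ℝ) :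
    laplacian σ (dirDeriv y p) = dirDeriv y (laplacian σ p) := by
  have hcomm : ∀ i j (q : MvPolynomial σ ℝ), pderiv i (pderiv j q) = pderiv j (pderiv i q) := by
    classical
    intro i j q
    ext m
    simp only [coeff_pderiv, add_right_comm m (Finsupp.single i 1), Finsupp.add_apply,
      Finsupp.single_apply]
    by_cases hij : i = j
    · subst hij; ring
    · simp [hij, Ne.symm hij]; ring
  simp only [laplacian_apply, dirDeriv_apply, map_sum, pderiv_C_mul]
  rw [Finset.sum_comm]
  refine Finset.sum_congr rfl fun i _ => Finset.sum_congr rfl fun j _ => ?_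
  rw [hcomm j i, hcomm j i]

theorem fischer_linForm_mul (y : σ → ℝ) (p q : MvPolynomial σ ℝ) :
    fischer (linForm y * p) q = fischer p (dirDeriv y q) := by
  simp only [linForm, dirDeriv_apply, Finset.sum_mul, map_sum, LinearMap.sum_apply,
    ← smul_eq_C_mul, smul_mul_assoc, map_smul, LinearMap.smul_apply, fischer_X_mul]

theorem fischer_normSqPoly_mul (p q : MvPolynomial σ ℝ) :
    fischer (normSqPoly σ * p) q = fischer p (laplacian σ q) := by
  simp only [normSqPoly, laplacian_apply, Finset.sum_mul, map_sum, LinearMap.sum_apply, mul_assoc,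
    fischer_X_mul]

theorem isHomogeneous_linForm (y : σ → ℝ) : (linForm y).IsHomogeneous 1 :=
  IsHomogeneous.sum _ _ _ fun i _ => by
    simpa using (isHomogeneous_C σ (y i)).mul (isHomogeneous_X ℝ i)

theorem isHomogeneous_normSqPoly : (normSqPoly σ).IsHomogeneous 2 :=
  IsHomogeneous.sum _ _ _ fun i _ => (isHomogeneous_X ℝ i).mul (isHomogeneous_X ℝ i)

theorem MvPolynomial.IsHomogeneous.dirDeriv {p : MvPolynomial σ ℝ} {n : ℕ}
    (hp : p.IsHomogeneous (n + 1)) (y : σ → ℝ) : (dirDeriv y p).IsHomogeneous n := by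
  rw [dirDeriv_apply]
  refine IsHomogeneous.sum _ _ _ fun i _ => ?_
  simpa using (isHomogeneous_C σ (y i)).mul (hp.pderiv (i := i))

theorem eval_dirDeriv_self {p : MvPolynomial σ ℝ} {n : ℕ} (hp : p.IsHomogeneous n) (y : σ → ℝ) :
    eval y (dirDeriv y p) = n * eval y p := by
  simpa [dirDeriv_apply] using congrArg (eval y) hp.sum_X_mul_pderiv

/-- The harmonic homogeneous polynomials of degree `n`. -/
noncomputable def harmonicSubmodule (σ : Type*) [Fintype σ] (n : ℕ) :
    Submodule ℝ (MvPolynomial σ ℝ) :=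
  homogeneousSubmodule σ ℝ n ⊓ LinearMap.ker (laplacian σ)

theorem mem_harmonicSubmodule {n : ℕ} {p : MvPolynomial σ ℝ} :
    p ∈ harmonicSubmodule σ n ↔ p.IsHomogeneous n ∧ laplacian σ p = 0 := Iff.rfl

instance (n : ℕ) : Module.Finite ℝ (homogeneousSubmodule σ ℝ n) :=
  Module.Finite.iff_fg.mpr (homogeneousSubmodule_fg σ ℝ n)

instance (n : ℕ) : Module.Finite ℝ (harmonicSubmodule σ n) :=
  Submodule.finiteDimensional_inf_left _ _

theorem finrank_homogeneousSubmodule (n : ℕ) :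
    Module.finrank ℝ (homogeneousSubmodule σ ℝ n) = (Fintype.card σ + n - 1).choose n := by
  classical
  have h : homogeneousSubmodule σ ℝ n = restrictSupport ℝ {d : σ →₀ ℕ | d.degree = n} :=
    homogeneousSubmodule_eq_finsupp_supported σ ℝ n
  rw [h, Module.finrank_eq_nat_card_basis (basisRestrictSupport ℝ {d : σ →₀ ℕ | d.degree = n}),
    ← Nat.card_eq_fintype_card, ← Sym.natCard_sym_eq_choose]
  exact Nat.card_congr (Sym.equivNatSum σ n).symm

theorem normSqPoly_ne_zero [Nonempty σ] : normSqPoly σ ≠ 0 := fun h => by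
  simpa [normSqPoly] using congrArg (eval fun _ : σ => (1 : ℝ)) h

theorem finrank_harmonicSubmodule_add_le [Nonempty σ] (n : ℕ) :
    Module.finrank ℝ (harmonicSubmodule σ (n + 2)) +
      Module.finrank ℝ (homogeneousSubmodule σ ℝ n) ≤
      Module.finrank ℝ (homogeneousSubmodule σ ℝ (n + 2)) := by
  set T := LinearMap.mulLeft ℝ (normSqPoly σ) ∘ₗ (homogeneousSubmodule σ ℝ n).subtype
  have hinj : Function.Injective T := fun p q h =>
    Subtype.ext (mul_left_cancel₀ normSqPoly_ne_zero h)
  have hdisj : harmonicSubmodule σ (n + 2) ⊓ LinearMap.range T = ⊥ := by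
    rw [eq_bot_iff]
    rintro _ ⟨hp, q, rfl⟩
    refine eq_zero_of_fischer_self_eq_zero ?_
    have h := fischer_normSqPoly_mul (q : MvPolynomial σ ℝ) (T q)
    rwa [(mem_harmonicSubmodule.mp hp).2, map_zero] at h
  rw [← LinearMap.finrank_range_of_inj hinj, ← Submodule.finrank_sup_add_finrank_inf_eq, hdisj,
    finrank_bot, add_zero]
  refine Submodule.finrank_mono (sup_le inf_le_left ?_)
  rintro _ ⟨q, rfl⟩
  have h := isHomogeneous_normSqPoly.mul q.2
  rwa [add_comm] at h

theorem finrank_harmonicSubmodule_le [Nonempty σ] (n : ℕ) :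
    Module.finrank ℝ (harmonicSubmodule σ n) ≤ hDim (Fintype.card σ) n := by
  unfold hDim
  split_ifs with hn
  · obtain ⟨n, rfl⟩ := Nat.exists_eq_add_of_le' hn
    have h := finrank_harmonicSubmodule_add_le (σ := σ) n
    rw [finrank_homogeneousSubmodule, finrank_homogeneousSubmodule] at h
    exact Nat.le_sub_of_add_le h
  · rw [Nat.sub_zero, ← finrank_homogeneousSubmodule]
    exact Submodule.finrank_mono inf_le_left

/-- The leading coefficient in the recurrence defining `Geg`. -/
noncomputable def gegLead (D : ℝ) (n : ℕ) : ℝ := (D + 2*(n+2) - 2)/((n : ℝ)+2)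

/-- The trailing coefficient in the recurrence defining `Geg`. -/
noncomputable def gegTail (D : ℝ) (n : ℕ) : ℝ := 1 - (n : ℝ)/(D+2*n-2)

theorem gegLead_pos {D : ℝ} (hD : 2 ≤ D) (n : ℕ) : 0 < gegLead D n :=
  div_pos (by have : (0 : ℝ) ≤ n := n.cast_nonneg; linarith) (by positivity)

theorem gegTail_zero (D : ℝ) : gegTail D 0 = 1 := by simp [gegTail]

theorem gegLead_zero (D : ℝ) : gegLead D 0 = (D + 2) / 2 := by simp [gegLead]; ring

theorem gegTail_succ {D : ℝ} (hD : 2 ≤ D) (n : ℕ) :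
    gegTail D (n + 1) = (D + n - 1) / (D + 2 * n) := by
  have h : D + 2 * n ≠ 0 := by positivity
  rw [gegTail, Nat.cast_succ, show D + 2 * ((n : ℝ) + 1) - 2 = D + 2 * n by ring]
  field_simp
  ring

theorem gegLead_mul_add {D : ℝ} (hD : 2 ≤ D) (n : ℕ) :
    gegLead D (n + 1) * (gegLead D n + (D + 2 * n) * gegTail D (n + 1)) =
      (D + 2 * (n + 2)) * gegTail D (n + 2) * gegLead D n := by
  have h : D + 2 * n ≠ 0 := by positivity
  have h' : D + 2 * (n + 1) ≠ 0 := by positivity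
  rw [gegTail_succ hD, gegTail_succ hD, gegLead, gegLead]
  push_cast
  field_simp
  ring

/-- The zonal harmonic with pole `y`, a homogenization of `x ↦ Geg d l ⟪x, y⟫`. -/
noncomputable def zonal (y : σ → ℝ) : ℕ → MvPolynomial σ ℝ
  | 0 => 1
  | 1 => C (Fintype.card σ : ℝ) * linForm y
  | (n+2) => C (gegLead (Fintype.card σ) n) *
      (linForm y * zonal y (n+1) - C (gegTail (Fintype.card σ) n) * (normSqPoly σ * zonal y n))

theorem isHomogeneous_zonal (y : σ → ℝ) : ∀ n, (zonal y n).IsHomogeneous n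
  | 0 => isHomogeneous_one σ ℝ
  | 1 => by
    have h := (isHomogeneous_C σ (Fintype.card σ : ℝ)).mul (isHomogeneous_linForm y)
    rwa [zero_add] at h
  | n+2 => by
    have h₁ := (isHomogeneous_linForm y).mul (isHomogeneous_zonal y (n + 1))
    have h₂ := (isHomogeneous_C σ (gegTail (Fintype.card σ) n)).mul
      (isHomogeneous_normSqPoly.mul (isHomogeneous_zonal y n))
    rw [show 1 + (n + 1) = n + 2 by ring] at h₁
    rw [show 0 + (2 + n) = n + 2 by ring] at h₂
    have h := (isHomogeneous_C σ (gegLead (Fintype.card σ) n)).mul (h₁.sub h₂)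
    rwa [zero_add] at h

theorem eval_zonal {x y : σ → ℝ} (hx : ∑ i, x i ^ 2 = 1) :
    ∀ n, eval x (zonal y n) = (Geg (Fintype.card σ) n).eval (∑ i, y i * x i)
  | 0 => by simp [zonal, Geg]
  | 1 => by simp [zonal, Geg, linForm]
  | n+2 => by
    simp [zonal, Geg, linForm, normSqPoly, eval_zonal hx (n + 1), eval_zonal hx n, ← pow_two, hx,
      gegLead, gegTail]

theorem dirDeriv_zonal_succ (hσ : 2 ≤ Fintype.card σ) {y : σ → ℝ} (hy : ∑ i, y i ^ 2 = 1) :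
    ∀ n : ℕ, dirDeriv y (zonal y (n + 1)) =
      C ((Fintype.card σ + 2 * n) * gegTail (Fintype.card σ) n) * zonal y n
  | 0 => by
    rw [zonal, zonal, dirDeriv_C_mul, dirDeriv_linForm hy, gegTail_zero, Nat.cast_zero, mul_zero,
      add_zero, mul_one, mul_one, mul_one]
  | 1 => by
    have hD : (2 : ℝ) ≤ Fintype.card σ := by exact_mod_cast hσ
    rw [zonal, zonal, zonal, zero_add, zonal, gegTail_zero, gegLead_zero, gegTail_succ hD]
    generalize (Fintype.card σ : ℝ) = D at hD
    have hD0 : D ≠ 0 := by positivity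
    have e : (D + 2 * (1 : ℕ)) * ((D + (0 : ℕ) - 1) / (D + 2 * (0 : ℕ))) * D =
        (D + 2) / 2 * (D + D - 2) := by
      push_cast
      field_simp
      ring
    have e' := congrArg (C : ℝ → MvPolynomial σ ℝ) e
    rw [C_1, one_mul, mul_one, dirDeriv_C_mul, map_sub, dirDeriv_mul, dirDeriv_C_mul,
      dirDeriv_linForm hy, dirDeriv_normSqPoly]
    rw [C_mul, C_mul (a := (D + 2) / 2), C_sub, C_add (a := D) (a' := D), map_ofNat C] at e'
    linear_combination (-linForm y) * e'
  | n+2 => by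
    have hD : (2 : ℝ) ≤ Fintype.card σ := by exact_mod_cast hσ
    have ih₁ := dirDeriv_zonal_succ hσ hy (n + 1)
    have ih₀ := dirDeriv_zonal_succ hσ hy n
    rw [zonal, dirDeriv_C_mul, map_sub, dirDeriv_C_mul, dirDeriv_mul, dirDeriv_mul, ih₁, ih₀,
      dirDeriv_linForm hy, dirDeriv_normSqPoly, zonal]
    have e := congrArg (C : ℝ → MvPolynomial σ ℝ) (gegLead_mul_add hD n)
    push_cast
    simp only [C_mul, C_add, map_ofNat C, C_1] at e ⊢
    linear_combination (linForm y * zonal y (n + 1) -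
      C (gegTail (Fintype.card σ) n) * (normSqPoly σ * zonal y n)) * e

theorem laplacian_zonal (hσ : 2 ≤ Fintype.card σ) {y : σ → ℝ} (hy : ∑ i, y i ^ 2 = 1) :
    ∀ n, laplacian σ (zonal y n) = 0
  | 0 => by simp [zonal, laplacian_apply]
  | 1 => by simp [zonal, laplacian_apply, pderiv_linForm]
  | n+2 => by
    rw [zonal, laplacian_C_mul, map_sub, laplacian_C_mul, laplacian_linForm_mul,
      laplacian_normSqPoly_mul (isHomogeneous_zonal y n), laplacian_zonal hσ hy (n + 1),
      laplacian_zonal hσ hy n, dirDeriv_zonal_succ hσ hy]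
    simp only [C_mul, C_add, map_ofNat C]
    ring

/-- The constant by which `fischer (zonal y n)` differs from evaluation at `y`. -/
noncomputable def zonalScale (D : ℝ) : ℕ → ℝ
  | 0 => 1
  | 1 => D
  | (n+2) => gegLead D n * ((n + 2) * zonalScale D (n + 1))

theorem zonalScale_pos {D : ℝ} (hD : 2 ≤ D) : ∀ n, 0 < zonalScale D n
  | 0 => one_pos
  | 1 => by rw [zonalScale]; positivity
  | n+2 => mul_pos (gegLead_pos hD n) (mul_pos (by positivity) (zonalScale_pos hD (n + 1)))

theorem dirDeriv_mem_harmonicSubmodule {n : ℕ} {p : MvPolynomial σ ℝ}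
    (hp : p ∈ harmonicSubmodule σ (n + 1)) (y : σ → ℝ) : dirDeriv y p ∈ harmonicSubmodule σ n :=
  ⟨hp.1.dirDeriv y, by
    change laplacian σ _ = 0
    rw [laplacian_dirDeriv, (mem_harmonicSubmodule.mp hp).2, map_zero]⟩

theorem fischer_zonal (y : σ → ℝ) : ∀ (n : ℕ) {p : MvPolynomial σ ℝ},
    p ∈ harmonicSubmodule σ n → fischer (zonal y n) p = zonalScale (Fintype.card σ) n * eval y p
  | 0, p, hp => by
    have h := totalDegree_eq_zero_iff_eq_C.mp
      ((totalDegree_zero_iff_isHomogeneous (p := p)).mpr hp.1)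
    rw [h, zonal, zonalScale, fischer_one]
    simp
  | 1, p, hp => by
    have h₀ := fischer_zonal y 0 (dirDeriv_mem_harmonicSubmodule hp y)
    rw [zonal, zonalScale, one_mul, eval_dirDeriv_self hp.1, Nat.cast_one, one_mul] at h₀
    rw [zonal, zonalScale, ← smul_eq_C_mul, map_smul, LinearMap.smul_apply, smul_eq_mul,
      ← mul_one (linForm y), fischer_linForm_mul, h₀]
  | n+2, p, hp => by
    have h₁ := fischer_zonal y (n + 1) (dirDeriv_mem_harmonicSubmodule hp y)
    rw [eval_dirDeriv_self hp.1] at h₁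
    simp only [zonal, zonalScale, ← smul_eq_C_mul, map_smul, LinearMap.smul_apply, map_sub,
      LinearMap.sub_apply, fischer_linForm_mul, fischer_normSqPoly_mul, h₁,
      (mem_harmonicSubmodule.mp hp).2, map_zero, smul_eq_mul]
    push_cast
    ring

theorem zonal_mem_harmonicSubmodule (hσ : 2 ≤ Fintype.card σ) {y : σ → ℝ}
    (hy : ∑ i, y i ^ 2 = 1) (n : ℕ) : zonal y n ∈ harmonicSubmodule σ n :=
  ⟨isHomogeneous_zonal y n, laplacian_zonal hσ hy n⟩

/-- The addition formula for zonal harmonics. -/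
theorem fischer_zonal_zonal (hσ : 2 ≤ Fintype.card σ) {x y : σ → ℝ} (hx : ∑ i, x i ^ 2 = 1)
    (hy : ∑ i, y i ^ 2 = 1) (n : ℕ) :
    fischer (zonal x n) (zonal y n) =
      zonalScale (Fintype.card σ) n * (Geg (Fintype.card σ) n).eval (∑ i, y i * x i) := by
  rw [fischer_zonal x n (zonal_mem_harmonicSubmodule hσ hy n), eval_zonal hx]

end ZonalHarmonics

/-- **Main theorem.** Let `X` be an `s`-distance set on `S^{d-1}` and
`F_X(t) = ∏_{α ∈ A(X)} (t - α) = Σ_{i=0}^s f_i G_i^{(d)}(t)` its Gegenbauer expansion.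
Then `|X| ≤ Σ_{i : f_i > 0} h_i`, summing over `0 ≤ i ≤ s` with `f_i > 0`. -/
theorem main_theorem (d s : ℕ) (hd : 2 ≤ d)
    (X : Finset (EuclideanSpace ℝ (Fin d)))
    (hsphere : ∀ x ∈ X, ‖x‖ = 1)
    (hdist : (innerSet X).card = s)
    (f : ℕ → ℝ)
    (hexp : ∏ α ∈ innerSet X, (Polynomial.X - Polynomial.C α) =
      ∑ i ∈ Finset.range (s + 1), Polynomial.C (f i) * Geg d i) :
    X.card ≤ ∑ i ∈ (Finset.range (s + 1)).filter (fun i => 0 < f i), hDim d i := by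
  classical
  have hcard : 2 ≤ Fintype.card (Fin d) := by simpa using hd
  have hD : (2 : ℝ) ≤ d := by exact_mod_cast hd
  have : Nonempty (Fin d) := ⟨⟨0, by omega⟩⟩
  have hunit : ∀ x ∈ X, ∑ i, x i ^ 2 = 1 := fun x hx => by
    rw [← EuclideanSpace.real_norm_sq_eq, hsphere x hx, one_pow]
  set P := (Finset.range (s + 1)).filter (fun i => 0 < f i)
  let Z (n : ℕ) : X → harmonicSubmodule (Fin d) n := fun x =>
    ⟨zonal x.1.ofLp n, zonal_mem_harmonicSubmodule hcard (hunit x x.2) n⟩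
  let T : (X → ℝ) →ₗ[ℝ] ((n : P) → harmonicSubmodule (Fin d) n) :=
    LinearMap.pi fun n => Fintype.linearCombination ℝ (Z n)
  have hform : ∀ (n : ℕ) (c : X → ℝ),
      fischer (∑ x, c x • zonal x.1.ofLp n) (∑ x, c x • zonal x.1.ofLp n) =
        zonalScale d n * ∑ x, ∑ y, c x * c y * (Geg d n).eval ⟪x.1, y.1⟫ := fun n c => by
    simp only [map_sum, map_smul, LinearMap.sum_apply, LinearMap.smul_apply, smul_eq_mul,
      Finset.mul_sum]
    rw [Finset.sum_comm]
    refine Finset.sum_congr rfl fun x _ => Finset.sum_congr rfl fun y _ => ?_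
    rw [fischer_zonal_zonal hcard (hunit x x.2) (hunit y y.2), Fintype.card_fin,
      PiLp.inner_apply]
    simp only [RCLike.inner_apply, conj_trivial]
    ring
  set F := ∏ α ∈ innerSet X, (Polynomial.X - Polynomial.C α)
  have hF_ne : ∀ x ∈ X, ∀ y ∈ X, x ≠ y → F.eval ⟪x, y⟫ = 0 := fun x hx y hy hxy => by
    rw [Polynomial.eval_prod]
    refine Finset.prod_eq_zero (i := ⟪x, y⟫) ?_ (by simp)
    exact Finset.mem_image.mpr ⟨(x, y), Finset.mem_offDiag.mpr ⟨hx, hy, hxy⟩, rfl⟩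
  have hF_one : 0 < F.eval 1 := by
    rw [Polynomial.eval_prod]
    refine Finset.prod_pos fun α hα => ?_
    obtain ⟨⟨x, y⟩, hxy, rfl⟩ := Finset.mem_image.mp hα
    obtain ⟨hx, hy, hne⟩ := Finset.mem_offDiag.mp hxy
    simpa using (inner_lt_one_iff_real_of_norm_eq_one (hsphere x hx) (hsphere y hy)).mpr hne
  have hker : ∀ c, T c = 0 → c = 0 := fun c hc => by
    have hle : F.eval 1 * ∑ x, c x ^ 2 ≤ 0 := calc
      F.eval 1 * ∑ x, c x ^ 2 = ∑ x, ∑ y, c x * c y * F.eval ⟪x.1, y.1⟫ := by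
        rw [Finset.mul_sum]
        refine Finset.sum_congr rfl fun x _ => ?_
        rw [Finset.sum_eq_single x (fun y _ hyx => ?_) (by simp)]
        · rw [real_inner_self_eq_norm_sq, hsphere x x.2, one_pow]
          ring
        · rw [hF_ne x x.2 y y.2 fun h => hyx (Subtype.ext h.symm), mul_zero]
      _ = ∑ n ∈ Finset.range (s + 1),
            f n * ∑ x, ∑ y, c x * c y * (Geg d n).eval ⟪x.1, y.1⟫ := by
        simp only [hexp, Polynomial.eval_finsetSum, Polynomial.eval_mul, Polynomial.eval_C,
          Finset.mul_sum]
        rw [eq_comm, Finset.sum_comm]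
        refine Finset.sum_congr rfl fun x _ => ?_
        rw [Finset.sum_comm]
        exact Finset.sum_congr rfl fun y _ => Finset.sum_congr rfl fun n _ => by ring
      _ ≤ 0 := by
        refine Finset.sum_nonpos fun n hn => ?_
        have hscale := zonalScale_pos hD n
        have hq := hform n c
        by_cases hfn : 0 < f n
        · have h := congrArg Subtype.val (congrFun hc ⟨n, Finset.mem_filter.mpr ⟨hn, hfn⟩⟩)
          have h0 : ∑ x, c x • zonal x.1.ofLp n = 0 := by
            simpa [T, Z, Fintype.linearCombination_apply] using h
          rw [h0, map_zero, eq_comm, mul_eq_zero] at hq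
          rw [hq.resolve_left hscale.ne', mul_zero]
        · refine mul_nonpos_of_nonpos_of_nonneg (not_lt.mp hfn) ?_
          exact nonneg_of_mul_nonneg_right (hq ▸ fischer_self_nonneg _) hscale
    have hsum : ∑ x, c x ^ 2 = 0 := le_antisymm (nonpos_of_mul_nonpos_right hle hF_one)
      (Finset.sum_nonneg fun _ _ => sq_nonneg _)
    rw [Finset.sum_eq_zero_iff_of_nonneg fun _ _ => sq_nonneg _] at hsum
    exact funext fun x => pow_eq_zero_iff two_ne_zero |>.mp (hsum x (Finset.mem_univ x))
  have hrank := LinearMap.finrank_le_finrank_of_injective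
    ((injective_iff_map_eq_zero T).mpr hker)
  rw [Module.finrank_pi, Fintype.card_coe, Module.finrank_pi_fintype] at hrank
  refine hrank.trans ?_
  rw [← Finset.sum_coe_sort P]
  refine Finset.sum_le_sum fun n _ => ?_
  simpa using finrank_harmonicSubmodule_le (σ := Fin d) n
end

section
/- (Musin's bound) Let X be a 2-distance set on the unit sphere S^{d-1} in ℝ^d with A(X) = {α, β}. If α + β ≥ 0, then |X| ≤ C(d+1, 2) = d(d+1)/2. -/
open scoped RealInnerProductSpace

/-- The quadratic monomials `x i * x j` of a vector, indexed by unordered pairs. -/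
noncomputable def quadraticMonomials {d : ℕ} (x : EuclideanSpace ℝ (Fin d)) :
    Sym2 (Fin d) → ℝ :=
  fun z => (z.map x).mul

lemma quadraticMonomials_mk {d : ℕ} (x : EuclideanSpace ℝ (Fin d)) (i j : Fin d) :
    quadraticMonomials x s(i, j) = x i * x j := by
  simp [quadraticMonomials]

lemma inner_sq_eq_sum {d : ℕ} (x y : EuclideanSpace ℝ (Fin d)) :
    ⟪x, y⟫ ^ 2 = ∑ i, ∑ j, quadraticMonomials x s(i, j) * (y i * y j) := by
  simp only [quadraticMonomials_mk, PiLp.inner_apply, RCLike.inner_apply, conj_trivial, sq,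
    Finset.sum_mul_sum]
  exact Finset.sum_congr rfl fun i _ => Finset.sum_congr rfl fun j _ => by ring

lemma norm_sq_eq_sum_quadraticMonomials {d : ℕ} (x : EuclideanSpace ℝ (Fin d)) :
    ‖x‖ ^ 2 = ∑ i, quadraticMonomials x s(i, i) := by
  simp only [EuclideanSpace.real_norm_sq_eq, quadraticMonomials_mk, ← sq]

/-- If `v` is a family of unit vectors whose inner products between distinct members are `α` or
`β`, with `α, β < 1` and `0 ≤ α + β`, then their vectors of quadratic monomials are linearly
independent. -/
lemma linearIndependent_quadraticMonomials {d : ℕ} {ι : Type*} [Fintype ι]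
    (v : ι → EuclideanSpace ℝ (Fin d)) (hv : ∀ i, ‖v i‖ = 1) {α β : ℝ} (hα : α < 1) (hβ : β < 1)
    (hαβ : 0 ≤ α + β) (h : ∀ i j, i ≠ j → ⟪v i, v j⟫ = α ∨ ⟪v i, v j⟫ = β) :
    LinearIndependent ℝ (fun i => quadraticMonomials (v i)) := by
  rw [Fintype.linearIndependent_iff]
  intro c hc
  have hz (z : Sym2 (Fin d)) : ∑ i, c i * quadraticMonomials (v i) z = 0 := by
    simpa [Finset.sum_apply] using congrFun hc z
  have hsum : ∑ i, c i = 0 := by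
    calc ∑ i, c i = ∑ i, c i * ‖v i‖ ^ 2 := by simp [hv]
      _ = ∑ k, ∑ i, c i * quadraticMonomials (v i) s(k, k) := by
        simp only [norm_sq_eq_sum_quadraticMonomials, Finset.mul_sum]
        exact Finset.sum_comm
      _ = 0 := by simp [hz]
  have hsq (y : EuclideanSpace ℝ (Fin d)) : ∑ i, c i * ⟪v i, y⟫ ^ 2 = 0 := by
    calc ∑ i, c i * ⟪v i, y⟫ ^ 2
        = ∑ k, ∑ l, (∑ i, c i * quadraticMonomials (v i) s(k, l)) * (y k * y l) := by
          simp only [inner_sq_eq_sum, Finset.mul_sum, Finset.sum_mul, mul_assoc]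
          rw [Finset.sum_comm]
          exact Finset.sum_congr rfl fun k _ => Finset.sum_comm
      _ = 0 := by simp [hz]
  have hkey (j : ι) : c j * ((1 - α) * (1 - β)) = -(α + β) * ⟪∑ i, c i • v i, v j⟫ := by
    calc c j * ((1 - α) * (1 - β))
        = ∑ i, c i * ((⟪v i, v j⟫ - α) * (⟪v i, v j⟫ - β)) := by
          rw [Finset.sum_eq_single j]
          · simp [hv]
          · intro i _ hij
            rcases h i j hij with e | e <;> simp [e]
          · simp
      _ = ∑ i, c i * ⟪v i, v j⟫ ^ 2 - (α + β) * ∑ i, c i * ⟪v i, v j⟫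
            + α * β * ∑ i, c i := by
        simp only [Finset.mul_sum, ← Finset.sum_sub_distrib, ← Finset.sum_add_distrib]
        exact Finset.sum_congr rfl fun i _ => by ring
      _ = -(α + β) * ⟪∑ i, c i • v i, v j⟫ := by
        simp only [hsq, hsum, sum_inner, real_inner_smul_left]
        ring
  have htotal : (∑ j, c j ^ 2) * ((1 - α) * (1 - β)) = -(α + β) * ‖∑ i, c i • v i‖ ^ 2 := by
    rw [← real_inner_self_eq_norm_sq, inner_sum, Finset.mul_sum, Finset.sum_mul]
    refine Finset.sum_congr rfl fun j _ => ?_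
    rw [real_inner_smul_right]
    linear_combination c j * hkey j
  have hpos : 0 < (1 - α) * (1 - β) := mul_pos (sub_pos.2 hα) (sub_pos.2 hβ)
  have hle : ∑ j, c j ^ 2 ≤ 0 := by
    refine nonpos_of_mul_nonpos_left ?_ hpos
    rw [htotal]
    nlinarith [mul_nonneg hαβ (sq_nonneg ‖∑ i, c i • v i‖)]
  have hzero := le_antisymm hle (Finset.sum_nonneg fun j _ => sq_nonneg (c j))
  intro i
  exact pow_eq_zero_iff two_ne_zero |>.1 <|
    (Finset.sum_eq_zero_iff_of_nonneg fun j _ => sq_nonneg (c j)).1 hzero i (Finset.mem_univ i)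

lemma mem_innerSet {d : ℕ} {X : Finset (EuclideanSpace ℝ (Fin d))} {t : ℝ} :
    t ∈ innerSet X ↔ ∃ x ∈ X, ∃ y ∈ X, x ≠ y ∧ ⟪x, y⟫ = t := by
  simp only [innerSet, Finset.mem_image, Finset.mem_offDiag, Prod.exists]
  grind

lemma lt_one_of_mem_innerSet {d : ℕ} {X : Finset (EuclideanSpace ℝ (Fin d))}
    (hsphere : ∀ x ∈ X, ‖x‖ = 1) {t : ℝ} (ht : t ∈ innerSet X) : t < 1 := by
  obtain ⟨x, hx, y, hy, hxy, rfl⟩ := mem_innerSet.1 ht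
  exact (inner_lt_one_iff_real_of_norm_eq_one (hsphere x hx) (hsphere y hy)).2 hxy

/-- **Musin's bound.** If `X` is a `2`-distance set on `S^{d-1}` with `A(X) = {α, β}` and
`α + β ≥ 0`, then `|X| ≤ C(d+1, 2) = d(d+1)/2`. -/
theorem musin_bound (d : ℕ)
    (X : Finset (EuclideanSpace ℝ (Fin d)))
    (hsphere : ∀ x ∈ X, ‖x‖ = 1)
    (α β : ℝ)
    (hA : innerSet X = {α, β})
    (hdist : (innerSet X).card = 2)
    (hαβ : 0 ≤ α + β) :
    X.card ≤ Nat.choose (d + 1) 2 ∧ Nat.choose (d + 1) 2 = d * (d + 1) / 2 := by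
  refine ⟨?_, by rw [Nat.choose_two_right, Nat.add_sub_cancel, mul_comm]⟩
  have hli := linearIndependent_quadraticMonomials (fun x : X => (x : EuclideanSpace ℝ (Fin d)))
    (fun x => hsphere x x.2) (lt_one_of_mem_innerSet hsphere (t := α) (by simp [hA]))
    (lt_one_of_mem_innerSet hsphere (t := β) (by simp [hA])) hαβ (fun x y hxy => by
      have hmem : ⟪(x : EuclideanSpace ℝ (Fin d)), y⟫ ∈ innerSet X :=
        mem_innerSet.2 ⟨x, x.2, y, y.2, Subtype.coe_ne_coe.2 hxy, rfl⟩
      simpa [hA] using hmem)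
  simpa [Sym2.card] using hli.fintype_card_le_finrank
end
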